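/- Assume Γ is Q-polynomial with respect to E. Then: (1) for 1 ≤ i ≤ d−1, c_i (θ*_1 − θ*_{i-1})(θ*_{i-1} − θ*_i)/(θ*_0 − θ*_i) + b_i (θ*_1 − θ*_{i+1})(θ*_{i+1} − θ*_i)/(θ*_0 − θ*_i) = (θ₂ − θ₁) θ*_i + θ₂ − θ₀, and (2) c_d (θ*_1 − θ*_{d-1})(θ*_{d-1} − θ*_d)/(θ*_0 − θ*_d) = (θ₂ − θ₁) θ*_d + θ₂ − θ₀. -/

import Mathlib

open Matrix Finset
open scoped Classical

/-- A distance-regular graph `Γ` with vertex set `X`, path-length distance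
`G.dist`, diameter `d ≥ 2`, and intersection numbers `p h i j`. -/
structure DRG where
  X : Type
  [fin : Fintype X]
  [deceq : DecidableEq X]
  G : SimpleGraph X
  conn : G.Connected
  d : ℕ
  d_ge_two : 2 ≤ d
  dist_le : ∀ x y : X, G.dist x y ≤ d
  dist_attained : ∃ x y : X, G.dist x y = d
  p : ℕ → ℕ → ℕ → ℕ
  dist_regular : ∀ (h i j : ℕ) (x y : X), G.dist x y = h →
    (Finset.univ.filter fun z => G.dist x z = i ∧ G.dist y z = j).card = p h i j

attribute [instance] DRG.fin DRG.deceq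

namespace DRG

variable (Γ : DRG)

/-- `Γ_i(x) = {z : ∂(x,z) = i}`. -/
noncomputable def sphere (x : Γ.X) (i : ℕ) : Finset Γ.X :=
  Finset.univ.filter fun z => Γ.G.dist x z = i

/-- The number of vertices `|X|`, as a real number. -/
noncomputable def n : ℝ := (Fintype.card Γ.X : ℝ)

/-- The `i`-th distance matrix `A_i`. -/
noncomputable def Ai (i : ℕ) : Matrix Γ.X Γ.X ℝ :=
  Matrix.of fun x y => if Γ.G.dist x y = i then (1 : ℝ) else 0

/-- The adjacency matrix `A = A_1`. -/
noncomputable def A : Matrix Γ.X Γ.X ℝ := Γ.Ai 1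

/-- The all-ones matrix `J`. -/
def Jmat : Matrix Γ.X Γ.X ℝ := Matrix.of fun _ _ => (1 : ℝ)

/-- `c_i = p^i_{1,i-1}` (so `c_0 = 0`). -/
noncomputable def c (i : ℕ) : ℝ := (Γ.p i 1 (i - 1) : ℝ)

/-- `a_i = p^i_{1,i}`. -/
noncomputable def a (i : ℕ) : ℝ := (Γ.p i 1 i : ℝ)

/-- `b_i = p^i_{1,i+1}` (so `b_d = 0`). -/
noncomputable def b (i : ℕ) : ℝ := (Γ.p i 1 (i + 1) : ℝ)

/-- The standard basis vector `x̂`. -/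
noncomputable def hatv (x : Γ.X) : Γ.X → ℝ := Pi.single x 1

/-- `x⁺_y = Σ_{z ∈ Γ(x) ∩ Γ_{i+1}(y)} ẑ` where `i = ∂(x,y)`. -/
noncomputable def plusv (x y : Γ.X) : Γ.X → ℝ :=
  ∑ z ∈ Γ.sphere x 1 ∩ Γ.sphere y (Γ.G.dist x y + 1), Γ.hatv z

/-- `x⁰_y = Σ_{z ∈ Γ(x) ∩ Γ_i(y)} ẑ` where `i = ∂(x,y)`. -/
noncomputable def zerov (x y : Γ.X) : Γ.X → ℝ :=
  ∑ z ∈ Γ.sphere x 1 ∩ Γ.sphere y (Γ.G.dist x y), Γ.hatv z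

/-- `x⁻_y = Σ_{z ∈ Γ(x) ∩ Γ_{i-1}(y)} ẑ` where `i = ∂(x,y)`
(for `i = 0` this is the zero vector, matching `Γ_{-1}(y) = ∅`). -/
noncomputable def minusv (x y : Γ.X) : Γ.X → ℝ :=
  ∑ z ∈ Γ.sphere x 1 ∩ Γ.sphere y (Γ.G.dist x y - 1), Γ.hatv z

/-- The Norton product `u ⋆ v = E (u ∘ v)`, where `∘` is the entrywise
(Hadamard) product of vectors. -/
noncomputable def norton (E : Matrix Γ.X Γ.X ℝ) (u v : Γ.X → ℝ) : Γ.X → ℝ :=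
  E *ᵥ (u * v)

/-- `E 0, …, E d` is the sequence of primitive idempotents of the Bose–Mesner
algebra, with `E 0 = |X|⁻¹ J`, and `θ 0, …, θ d` are the corresponding
(mutually distinct) eigenvalues, so that `A = Σ_i θ i • E i`. -/
def IsPrimIdemSeq (E : ℕ → Matrix Γ.X Γ.X ℝ) (θ : ℕ → ℝ) : Prop :=
  E 0 = (Γ.n)⁻¹ • Γ.Jmat ∧
  ∑ i ∈ Finset.range (Γ.d + 1), E i = 1 ∧
  (∀ i j : ℕ, i ≤ Γ.d → j ≤ Γ.d → E i * E j = if i = j then E i else 0) ∧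
  Γ.A = ∑ i ∈ Finset.range (Γ.d + 1), θ i • E i ∧
  (∀ i j : ℕ, i ≤ Γ.d → j ≤ Γ.d → θ i = θ j → i = j)

/-- `q h i j` are the Krein parameters:
`E i ∘ E j = |X|⁻¹ Σ_h q h i j • E h`, with `∘` the entrywise product. -/
def IsKrein (E : ℕ → Matrix Γ.X Γ.X ℝ) (q : ℕ → ℕ → ℕ → ℝ) : Prop :=
  ∀ i j : ℕ, i ≤ Γ.d → j ≤ Γ.d →
    Matrix.hadamard (E i) (E j) =
      (Γ.n)⁻¹ • ∑ h ∈ Finset.range (Γ.d + 1), q h i j • E h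

/-- The ordering `E 1, …, E d` is `Q`-polynomial: for `0 ≤ h,i,j ≤ d`,
`q h i j = 0` if one of `h,i,j` is greater than the sum of the other two, and
`q h i j ≠ 0` if one of `h,i,j` equals the sum of the other two. -/
def IsQPolynomial (q : ℕ → ℕ → ℕ → ℝ) : Prop :=
  ∀ h i j : ℕ, h ≤ Γ.d → i ≤ Γ.d → j ≤ Γ.d →
    ((i + j < h ∨ h + j < i ∨ h + i < j) → q h i j = 0) ∧
    ((h = i + j ∨ i = h + j ∨ j = h + i) → q h i j ≠ 0)

/-- `ts 0, …, ts d` are the (mutually distinct) dual eigenvalues associated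
with `E`, i.e. `E = |X|⁻¹ Σ_i ts i • A i`.  The values `ts (-1)` and
`ts (d+1)` are arbitrary reals (indeterminates). -/
def IsDualEigs (E : Matrix Γ.X Γ.X ℝ) (ts : ℤ → ℝ) : Prop :=
  E = (Γ.n)⁻¹ • ∑ i ∈ Finset.range (Γ.d + 1), ts i • Γ.Ai i

/-- The dual eigenvalues `ts 0, …, ts d` are mutually distinct. -/
def DualDistinct (ts : ℤ → ℝ) : Prop :=
  ∀ i j : ℕ, i ≤ Γ.d → j ≤ Γ.d → ts i = ts j → i = j

/-- `C(x,y) = E x⁻_y − c_i ((θ*_1 − θ*_{i-1})/(θ*_0 − θ*_i)) E x̂`,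
where `i = ∂(x,y)`. -/
noncomputable def Cvec (E : Matrix Γ.X Γ.X ℝ) (ts : ℤ → ℝ) (x y : Γ.X) :
    Γ.X → ℝ :=
  E *ᵥ Γ.minusv x y -
    (Γ.c (Γ.G.dist x y) *
      ((ts 1 - ts ((Γ.G.dist x y : ℤ) - 1)) / (ts 0 - ts (Γ.G.dist x y)))) •
      (E *ᵥ Γ.hatv x)

/-- `B(x,y) = E x⁺_y − b_i ((θ*_1 − θ*_{i+1})/(θ*_0 − θ*_i)) E x̂`,
where `i = ∂(x,y)`. -/
noncomputable def Bvec (E : Matrix Γ.X Γ.X ℝ) (ts : ℤ → ℝ) (x y : Γ.X) :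
    Γ.X → ℝ :=
  E *ᵥ Γ.plusv x y -
    (Γ.b (Γ.G.dist x y) *
      ((ts 1 - ts ((Γ.G.dist x y : ℤ) + 1)) / (ts 0 - ts (Γ.G.dist x y)))) •
      (E *ᵥ Γ.hatv x)

end DRG

namespace DRG

variable {Γ : DRG}

theorem exists_dist_eq {i : ℕ} (hi : i ≤ Γ.d) : ∃ x y : Γ.X, Γ.G.dist x y = i := by
  obtain ⟨x, y, hxy⟩ := Γ.dist_attained
  obtain ⟨w, hw⟩ := Γ.conn.exists_walk_length_eq_dist x y
  have h₁ := SimpleGraph.dist_le (w.take i)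
  have h₂ := SimpleGraph.dist_le (w.drop i)
  have h₃ := Γ.conn.dist_triangle (u := x) (v := w.getVert i) (w := y)
  rw [SimpleGraph.Walk.take_length] at h₁
  rw [SimpleGraph.Walk.drop_length] at h₂
  exact ⟨x, w.getVert i, by omega⟩

theorem n_ne_zero : Γ.n ≠ 0 := by
  have : Nonempty Γ.X := Γ.conn.nonempty
  simp [n]

theorem b_diameter : Γ.b Γ.d = 0 := by
  obtain ⟨x, y, hxy⟩ := Γ.dist_attained
  have h := Γ.dist_regular Γ.d 1 (Γ.d + 1) x y hxy
  rw [b, ← h, Nat.cast_eq_zero, Finset.card_eq_zero, Finset.filter_eq_empty_iff]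
  rintro z - ⟨-, hz⟩
  have := Γ.dist_le y z
  omega

theorem sum_A_mul_zero (f : ℤ → ℝ) (x : Γ.X) :
    ∑ z, Γ.A x z * f (Γ.G.dist z x) = Γ.b 0 * f 1 := by
  have h := Γ.dist_regular 0 1 1 x x SimpleGraph.dist_self
  have hterm (z : Γ.X) : Γ.A x z * f (Γ.G.dist z x) =
      if Γ.G.dist x z = 1 ∧ Γ.G.dist x z = 1 then f 1 else 0 := by
    rw [SimpleGraph.dist_comm (u := z)]
    by_cases hz : Γ.G.dist x z = 1 <;> simp [A, Ai, hz, -SimpleGraph.dist_eq_one_iff_adj]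
  simp_rw [hterm]
  rw [← Finset.sum_filter, Finset.sum_const, h, nsmul_eq_mul, b]

theorem sum_A_mul (f : ℤ → ℝ) {i : ℕ} (hi : 1 ≤ i) {x y : Γ.X} (hxy : Γ.G.dist x y = i) :
    ∑ z, Γ.A x z * f (Γ.G.dist z y) =
      Γ.c i * f ((i : ℤ) - 1) + Γ.a i * f i + Γ.b i * f ((i : ℤ) + 1) := by
  have hterm (z : Γ.X) : Γ.A x z * f (Γ.G.dist z y) =
      (if Γ.G.dist x z = 1 ∧ Γ.G.dist y z = i - 1 then f ((i : ℤ) - 1) else 0) +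
      (if Γ.G.dist x z = 1 ∧ Γ.G.dist y z = i then f i else 0) +
      (if Γ.G.dist x z = 1 ∧ Γ.G.dist y z = i + 1 then f ((i : ℤ) + 1) else 0) := by
    rw [SimpleGraph.dist_comm (u := z)]
    by_cases hz : Γ.G.dist x z = 1
    · have h₁ := Γ.conn.dist_triangle (u := x) (v := z) (w := y)
      have h₂ := Γ.conn.dist_triangle (u := z) (v := x) (w := y)
      rw [SimpleGraph.dist_comm (u := z) (v := y)] at h₁ h₂
      rw [SimpleGraph.dist_comm (u := z) (v := x)] at h₂
      have hcases : Γ.G.dist y z = i - 1 ∨ Γ.G.dist y z = i ∨ Γ.G.dist y z = i + 1 := by omega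
      obtain ⟨j, rfl⟩ : ∃ j, i = j + 1 := ⟨i - 1, by omega⟩
      rcases hcases with h | h | h <;>
        simp [A, Ai, hz, h, -SimpleGraph.dist_eq_one_iff_adj]
      all_goals omega
    · simp [A, Ai, hz, -SimpleGraph.dist_eq_one_iff_adj]
  simp_rw [hterm]
  rw [Finset.sum_add_distrib, Finset.sum_add_distrib]
  simp only [← Finset.sum_filter, Finset.sum_const, Γ.dist_regular i _ _ x y hxy, nsmul_eq_mul,
    a, b, c]

theorem IsDualEigs.apply {M : Matrix Γ.X Γ.X ℝ} {ts : ℤ → ℝ} (h : Γ.IsDualEigs M ts)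
    (x y : Γ.X) : M x y = Γ.n⁻¹ * ts (Γ.G.dist x y) := by
  have hd := Γ.dist_le x y
  rw [h]
  simp [Matrix.sum_apply, Ai, Nat.lt_succ_of_le hd]

section

variable {E : ℕ → Matrix Γ.X Γ.X ℝ} {θ : ℕ → ℝ} {q : ℕ → ℕ → ℕ → ℝ}

theorem IsPrimIdemSeq.A_mul (hE : Γ.IsPrimIdemSeq E θ) {h : ℕ} (hh : h ≤ Γ.d) :
    Γ.A * E h = θ h • E h := by
  obtain ⟨-, -, horth, hA, -⟩ := hE
  rw [hA, Finset.sum_mul, Finset.sum_eq_single_of_mem h (by simpa using Nat.lt_succ_of_le hh)]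
  · simp [horth h h hh hh]
  · intro j hj hjh
    have hj' : j ≤ Γ.d := by simpa [Nat.lt_succ_iff] using hj
    simp [horth j h hj' hh, hjh]

theorem hadamard_one_one (hq : Γ.IsKrein E q) (hQ : Γ.IsQPolynomial q) :
    Matrix.hadamard (E 1) (E 1) =
      Γ.n⁻¹ • (q 0 1 1 • E 0 + q 1 1 1 • E 1 + q 2 1 1 • E 2) := by
  have hd := Γ.d_ge_two
  rw [hq 1 1 (by omega) (by omega)]
  congr 1
  rw [← Finset.sum_subset (s₁ := Finset.range 3)]
  · simp [Finset.sum_range_succ]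
  · intro j
    simp only [Finset.mem_range]
    omega
  · intro j hj hj'
    simp only [Finset.mem_range] at hj hj'
    rw [(hQ j 1 1 (by omega) (by omega) (by omega)).1 (by omega), zero_smul]

variable {ts : ℤ → ℝ}

/-- The Krein parameter `q 0 1 1` is the multiplicity `θ*_0` of `E 1`. -/
theorem krein_zero_one_one (hE : Γ.IsPrimIdemSeq E θ) (hq : Γ.IsKrein E q)
    (hQ : Γ.IsQPolynomial q) (hts : Γ.IsDualEigs (E 1) ts) : q 0 1 1 = ts 0 := by
  have hd := Γ.d_ge_two
  have hn := Γ.n_ne_zero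
  obtain ⟨h0, -, horth, -, -⟩ := hE
  obtain ⟨x⟩ : Nonempty Γ.X := Γ.conn.nonempty
  have key : Matrix.hadamard (E 1) (E 1) * E 0 = (Γ.n⁻¹ * q 0 1 1) • E 0 := by
    rw [hadamard_one_one hq hQ, Matrix.smul_mul, Matrix.add_mul, Matrix.add_mul,
      Matrix.smul_mul, Matrix.smul_mul, Matrix.smul_mul, horth 0 0 (by omega) (by omega),
      horth 1 0 (by omega) (by omega), horth 2 0 (by omega) (by omega)]
    simp [smul_smul]
  have hidem := congrFun₂ (horth 1 1 (by omega) (by omega)) x x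
  rw [if_pos rfl, Matrix.mul_apply, hts.apply x x, SimpleGraph.dist_self] at hidem
  have hentry := congrFun₂ key x x
  have hsq (z : Γ.X) : E 1 x z * E 1 x z = E 1 x z * E 1 z x := by
    rw [hts.apply x z, hts.apply z x, SimpleGraph.dist_comm]
  rw [Matrix.mul_apply] at hentry
  simp only [h0, Matrix.hadamard_apply, Matrix.smul_apply, Jmat, Matrix.of_apply, smul_eq_mul,
    mul_one, hsq, ← Finset.sum_mul, hidem] at hentry
  field_simp at hentry
  simpa using hentry.symm

/-- The difference `A (E ∘ E) − θ₂ (E ∘ E)` involves only `E 0` and `E 1`. -/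
theorem A_mul_hadamard (hE : Γ.IsPrimIdemSeq E θ) (hq : Γ.IsKrein E q)
    (hQ : Γ.IsQPolynomial q) :
    Γ.A * Matrix.hadamard (E 1) (E 1) = θ 2 • Matrix.hadamard (E 1) (E 1) +
      Γ.n⁻¹ • ((q 0 1 1 * (θ 0 - θ 2)) • E 0 + (q 1 1 1 * (θ 1 - θ 2)) • E 1) := by
  have hd := Γ.d_ge_two
  rw [hadamard_one_one hq hQ]
  simp only [Matrix.mul_smul, Matrix.mul_add, hE.A_mul (Nat.zero_le _),
    hE.A_mul (show 1 ≤ Γ.d by omega), hE.A_mul hd]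
  module

theorem sum_A (hE : Γ.IsPrimIdemSeq E θ) (x : Γ.X) : ∑ z, Γ.A x z = θ 0 := by
  have h := congrFun₂ (hE.A_mul (Nat.zero_le _)) x x
  rw [Matrix.mul_apply] at h
  simp only [hE.1, Matrix.smul_apply, Jmat, Matrix.of_apply, smul_eq_mul, mul_one,
    ← Finset.sum_mul] at h
  exact mul_right_cancel₀ (inv_ne_zero Γ.n_ne_zero) h

theorem sum_A_mul_dual (hE : Γ.IsPrimIdemSeq E θ) (hts : Γ.IsDualEigs (E 1) ts) (x y : Γ.X) :
    ∑ z, Γ.A x z * ts (Γ.G.dist z y) = θ 1 * ts (Γ.G.dist x y) := by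
  have hd := Γ.d_ge_two
  have hn := Γ.n_ne_zero
  have h := congrFun₂ (hE.A_mul (show 1 ≤ Γ.d by omega)) x y
  simp only [Matrix.mul_apply, Matrix.smul_apply, hts.apply, smul_eq_mul,
    mul_left_comm _ Γ.n⁻¹, ← Finset.mul_sum] at h
  exact mul_left_cancel₀ (inv_ne_zero hn) h

theorem sum_A_mul_dual_sq (hE : Γ.IsPrimIdemSeq E θ) (hq : Γ.IsKrein E q)
    (hQ : Γ.IsQPolynomial q) (hts : Γ.IsDualEigs (E 1) ts) (x y : Γ.X) :
    ∑ z, Γ.A x z * ts (Γ.G.dist z y) ^ 2 = θ 2 * ts (Γ.G.dist x y) ^ 2 +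
      ts 0 * (θ 0 - θ 2) + q 1 1 1 * (θ 1 - θ 2) * ts (Γ.G.dist x y) := by
  have hn := Γ.n_ne_zero
  have h := congrFun₂ (A_mul_hadamard hE hq hQ) x y
  have hterm (z : Γ.X) : Γ.A x z * (Γ.n⁻¹ * ts (Γ.G.dist z y) * (Γ.n⁻¹ * ts (Γ.G.dist z y))) =
      Γ.n⁻¹ ^ 2 * (Γ.A x z * ts (Γ.G.dist z y) ^ 2) := by ring
  simp only [Matrix.mul_apply, Matrix.add_apply, Matrix.smul_apply, Matrix.hadamard_apply,
    hts.apply, smul_eq_mul, hterm, ← Finset.mul_sum, hE.1, Jmat, Matrix.of_apply,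
    krein_zero_one_one hE hq hQ hts] at h
  refine mul_left_cancel₀ (pow_ne_zero 2 (inv_ne_zero hn)) (h.trans ?_)
  ring

/-- The identity of `ci_bi_identity` before division by `θ*_0 − θ*_i`. -/
theorem c_b_identity (hE : Γ.IsPrimIdemSeq E θ) (hq : Γ.IsKrein E q)
    (hQ : Γ.IsQPolynomial q) (hts : Γ.IsDualEigs (E 1) ts) (hts' : Γ.DualDistinct ts)
    {i : ℕ} (hi : 1 ≤ i) (hid : i ≤ Γ.d) :
    Γ.c i * (ts 1 - ts ((i : ℤ) - 1)) * (ts ((i : ℤ) - 1) - ts i) +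
      Γ.b i * (ts 1 - ts ((i : ℤ) + 1)) * (ts ((i : ℤ) + 1) - ts i) =
    ((θ 2 - θ 1) * ts i + θ 2 - θ 0) * (ts 0 - ts i) := by
  have hd := Γ.d_ge_two
  obtain ⟨x, y, hxy⟩ := exists_dist_eq hid
  have hk : Γ.b 0 = θ 0 := by
    simpa using (sum_A_mul_zero (fun _ => 1) x).symm.trans (by simpa using sum_A hE x)
  have hk₁ : θ 0 * ts 1 = θ 1 * ts 0 := by
    rw [← hk, ← sum_A_mul_zero ts x, sum_A_mul_dual hE hts, SimpleGraph.dist_self, Nat.cast_zero]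
  have hk₂ := (sum_A_mul_zero (fun j => ts j ^ 2) x).symm.trans
    (sum_A_mul_dual_sq hE hq hQ hts x x)
  rw [hk, SimpleGraph.dist_self, Nat.cast_zero] at hk₂
  have hθ : θ 0 ≠ 0 := by
    obtain ⟨u, v, huv⟩ := exists_dist_eq (Γ := Γ) (i := 1) (by omega)
    rw [← hk, b, ← Γ.dist_regular 0 1 1 u u SimpleGraph.dist_self, Nat.cast_ne_zero]
    exact Finset.card_ne_zero_of_mem (a := v) (by simp [huv, -SimpleGraph.dist_eq_one_iff_adj])
  have ht : ts 0 ≠ 0 := by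
    intro h0
    have h1 : ts 1 = 0 := by simpa [h0, hθ] using hk₁
    have := hts' 0 1 (by omega) (by omega) (by simp [h0, h1])
    omega
  have hQ₁ : q 1 1 1 * (θ 1 - θ 2) = θ 1 * ts 1 - θ 2 * ts 0 - θ 0 + θ 2 := by
    apply mul_left_cancel₀ ht
    linear_combination -hk₂ + ts 1 * hk₁
  have e₀ : Γ.c i + Γ.a i + Γ.b i = θ 0 := by
    simpa using (sum_A_mul (fun _ => 1) hi hxy).symm.trans (by simpa using sum_A hE x)
  have e₁ := (sum_A_mul ts hi hxy).symm.trans (sum_A_mul_dual hE hts x y)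
  have e₂ := (sum_A_mul (fun j => ts j ^ 2) hi hxy).symm.trans
    (sum_A_mul_dual_sq hE hq hQ hts x y)
  rw [hxy] at e₁ e₂
  rw [hQ₁] at e₂
  linear_combination (ts 1 + ts i) * e₁ - e₂ - ts 1 * ts i * e₀ - ts i * hk₁

end

end DRG

/-- Lemma 4.4. -/
theorem DRG.ci_bi_identity (Γ : DRG) (E : ℕ → Matrix Γ.X Γ.X ℝ) (θ : ℕ → ℝ)
    (hE : Γ.IsPrimIdemSeq E θ)
    (q : ℕ → ℕ → ℕ → ℝ) (hq : Γ.IsKrein E q) (hQ : Γ.IsQPolynomial q)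
    (ts : ℤ → ℝ) (hts : Γ.IsDualEigs (E 1) ts) (hts' : Γ.DualDistinct ts) :
    (∀ i : ℕ, 1 ≤ i → i ≤ Γ.d - 1 →
      Γ.c i * (ts 1 - ts ((i : ℤ) - 1)) * (ts ((i : ℤ) - 1) - ts i) /
          (ts 0 - ts i) +
        Γ.b i * (ts 1 - ts ((i : ℤ) + 1)) * (ts ((i : ℤ) + 1) - ts i) /
          (ts 0 - ts i) =
        (θ 2 - θ 1) * ts i + θ 2 - θ 0) ∧
    Γ.c Γ.d * (ts 1 - ts ((Γ.d : ℤ) - 1)) * (ts ((Γ.d : ℤ) - 1) - ts (Γ.d : ℤ)) /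
        (ts 0 - ts (Γ.d : ℤ)) =
      (θ 2 - θ 1) * ts (Γ.d : ℤ) + θ 2 - θ 0 := by
  have hne {i : ℕ} (hi : 1 ≤ i) (hid : i ≤ Γ.d) : ts 0 - ts (i : ℤ) ≠ 0 := by
    intro h
    have := hts' 0 i (Nat.zero_le _) hid (by simpa using sub_eq_zero.mp h)
    omega
  have hd := Γ.d_ge_two
  refine ⟨fun i hi hid => ?_, ?_⟩
  · rw [← add_div, div_eq_iff (hne hi (by omega))]
    exact c_b_identity hE hq hQ hts hts' hi (by omega)
  · have h := c_b_identity hE hq hQ hts hts' (i := Γ.d) (by omega) le_rfl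
    rw [b_diameter] at h
    rw [div_eq_iff (hne (by omega) le_rfl)]
    linear_combination h
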